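/- arXiv:0905.3419 — 2 statements merged into one kernel-verified Lean document; each statement's English description precedes it below -/
import Mathlib

section
/- Let ρ₀ and ρ₁ be density matrices on ℂⁿ with intrinsic purifications ψ̂₀, ψ̂₁ ∈ ℂⁿ ⊗ ℂⁿ (built from unitaries U₀, U₁ and nonnegative vectors p₀, p₁ with U_bᴴ ρ_b U_b = diag(p_{b,1},…,p_{b,n})). Then |⟨ψ̂₀, ψ̂₁⟩| ≥ 1 − D(ρ₀,ρ₁), where D(ρ₀,ρ₁) = ½‖ρ₀ − ρ₁‖₁ is the trace distance. -/
open Matrix Complex Finset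
open scoped ComplexOrder

open scoped MatrixOrder in
/-- The trace norm `‖A‖₁ = Tr √(Aᴴ A)`. -/
noncomputable def traceNorm {ι : Type*} [Fintype ι] [DecidableEq ι]
    (A : Matrix ι ι ℂ) : ℝ :=
  ((CFC.sqrt (Aᴴ * A)).trace).re

/-- The trace distance `D(ρ,σ) = ½‖ρ − σ‖₁`. -/
noncomputable def traceDist {ι : Type*} [Fintype ι] [DecidableEq ι]
    (ρ σ : Matrix ι ι ℂ) : ℝ :=
  traceNorm (ρ - σ) / 2

/-- If `-T ≤ H ≤ T` in the Loewner order, then the diagonal entries of `H` in any frame are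
dominated by those of `T`. -/
lemma abs_re_conj_diag_le {ι : Type*} [Fintype ι] {H T : Matrix ι ι ℂ}
    (hadd : (T + H).PosSemidef) (hsub : (T - H).PosSemidef) (V : Matrix ι ι ℂ) (i : ι) :
    |((Vᴴ * H * V) i i).re| ≤ ((Vᴴ * T * V) i i).re := by
  have h₁ := (Complex.le_def.1 ((hadd.conjTranspose_mul_mul_same V).diag_nonneg (i := i))).1
  have h₂ := (Complex.le_def.1 ((hsub.conjTranspose_mul_mul_same V).diag_nonneg (i := i))).1
  simp only [Matrix.mul_add, Matrix.add_mul, Matrix.mul_sub, Matrix.sub_mul, Matrix.add_apply,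
    Matrix.sub_apply, Complex.add_re, Complex.sub_re, Complex.zero_re] at h₁ h₂
  rw [abs_le]
  constructor <;> linarith

lemma trace_unitary_conj {ι : Type*} [Fintype ι] [DecidableEq ι] {V : Matrix ι ι ℂ}
    (hV : V ∈ Matrix.unitaryGroup ι ℂ) (T : Matrix ι ι ℂ) :
    (Vᴴ * T * V).trace = T.trace := by
  rw [Matrix.trace_mul_comm, ← Matrix.mul_assoc, ← Matrix.star_eq_conjTranspose,
    Matrix.mem_unitaryGroup_iff.1 hV, Matrix.one_mul]

open scoped MatrixOrder in
/-- The diagonal of a Hermitian matrix in an orthonormal basis has `ℓ¹` norm at most its trace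
norm. -/
lemma sum_abs_re_conj_diag_le_traceNorm {ι : Type*} [Fintype ι] [DecidableEq ι]
    {H V : Matrix ι ι ℂ} (hH : H.IsHermitian) (hV : V ∈ Matrix.unitaryGroup ι ℂ) :
    ∑ i, |((Vᴴ * H * V) i i).re| ≤ traceNorm H := by
  have hadd : (CFC.abs H + H).PosSemidef := by
    rw [← Matrix.nonneg_iff_posSemidef, CFC.abs_add_self H hH.isSelfAdjoint, two_smul]
    exact add_nonneg (CFC.posPart_nonneg H) (CFC.posPart_nonneg H)
  have hsub : (CFC.abs H - H).PosSemidef := by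
    rw [← Matrix.nonneg_iff_posSemidef, CFC.abs_sub_self H hH.isSelfAdjoint, two_smul]
    exact add_nonneg (CFC.negPart_nonneg H) (CFC.negPart_nonneg H)
  calc ∑ i, |((Vᴴ * H * V) i i).re| ≤ ∑ i, ((Vᴴ * CFC.abs H * V) i i).re :=
        Finset.sum_le_sum fun i _ => abs_re_conj_diag_le hadd hsub V i
    _ = ((Vᴴ * CFC.abs H * V).trace).re := by simp [Matrix.trace]
    _ = traceNorm H := by rw [trace_unitary_conj hV]; rfl

/-- The **Powers–Størmer inequality**. -/
theorem re_trace_sub_mul_sub_le_traceNorm {ι : Type*} [Fintype ι] [DecidableEq ι]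
    {A B : Matrix ι ι ℂ} (hA : A.PosSemidef) (hB : B.PosSemidef) :
    (((A - B) * (A - B)).trace).re ≤ traceNorm (A * A - B * B) := by
  have hC : (A - B).IsHermitian := hA.isHermitian.sub hB.isHermitian
  set V : Matrix ι ι ℂ := (hC.eigenvectorUnitary).1
  have hV : V ∈ Matrix.unitaryGroup ι ℂ := hC.eigenvectorUnitary.2
  set D : Matrix ι ι ℂ := Matrix.diagonal fun i => (hC.eigenvalues i : ℂ) with hD
  have hVV : V * Vᴴ = 1 := Matrix.mem_unitaryGroup_iff.1 hV
  have hVV' : Vᴴ * V = 1 := Matrix.mem_unitaryGroup_iff'.1 hV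
  have hspec : A - B = V * D * Vᴴ := by
    conv_lhs => rw [hC.spectral_theorem]
    rfl
  have hCV : (A - B) * V = V * D := by
    rw [hspec, Matrix.mul_assoc, hVV', Matrix.mul_one]
  have hVC : Vᴴ * (A - B) = D * Vᴴ := by
    rw [hspec, ← Matrix.mul_assoc, ← Matrix.mul_assoc, hVV', Matrix.one_mul]
  have hdiag : Vᴴ * (A - B) * V = D := by
    rw [hVC, Matrix.mul_assoc, hVV', Matrix.mul_one]
  have htrace : (((A - B) * (A - B)).trace).re = ∑ i, hC.eigenvalues i ^ 2 := by
    have h : Vᴴ * ((A - B) * (A - B)) * V = D * D := by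
      rw [← Matrix.mul_assoc, hVC, Matrix.mul_assoc, hCV, Matrix.mul_assoc,
        ← Matrix.mul_assoc Vᴴ, hVV', Matrix.one_mul]
    rw [← trace_unitary_conj hV, h, hD, Matrix.diagonal_mul_diagonal, Matrix.trace_diagonal]
    simp [sq]
  have hsq : Vᴴ * (A * A - B * B) * V + Vᴴ * (A * A - B * B) * V
      = D * (Vᴴ * (A + B) * V) + (Vᴴ * (A + B) * V) * D := by
    have h₁ : D * (Vᴴ * (A + B) * V) = Vᴴ * ((A - B) * (A + B)) * V := by
      rw [← Matrix.mul_assoc, ← Matrix.mul_assoc, ← hVC]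
      simp only [Matrix.mul_assoc]
    have h₂ : (Vᴴ * (A + B) * V) * D = Vᴴ * ((A + B) * (A - B)) * V := by
      rw [Matrix.mul_assoc, ← hCV]
      simp only [Matrix.mul_assoc]
    rw [h₁, h₂]
    noncomm_ring
  have hentry (i : ι) : ((Vᴴ * (A * A - B * B) * V) i i).re
      = hC.eigenvalues i * ((Vᴴ * (A + B) * V) i i).re := by
    have h := congrArg Complex.re (congrFun (congrFun hsq i) i)
    simp only [Matrix.add_apply, hD, Matrix.diagonal_mul, Matrix.mul_diagonal, Complex.add_re,
      Complex.re_ofReal_mul, Complex.re_mul_ofReal] at h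
    linarith
  have hdom (i : ι) : |hC.eigenvalues i| ≤ ((Vᴴ * (A + B) * V) i i).re := by
    have h := abs_re_conj_diag_le (H := A - B) (T := A + B)
      (by convert hA.add hA using 1; abel) (by convert hB.add hB using 1; abel) V i
    rwa [hdiag, hD, Matrix.diagonal_apply_eq, Complex.ofReal_re] at h
  have hH : (A * A - B * B).IsHermitian := by
    simp [Matrix.IsHermitian, hA.isHermitian.eq, hB.isHermitian.eq]
  rw [htrace]
  refine le_trans (Finset.sum_le_sum fun i _ => ?_) (sum_abs_re_conj_diag_le_traceNorm hH hV)
  rw [hentry, abs_mul, ← sq_abs, sq]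
  exact mul_le_mul_of_nonneg_left ((hdom i).trans (le_abs_self _)) (abs_nonneg _)

/-- A diagonalization `Uᴴ ρ U = diag p` with `p ≥ 0` gives a positive semidefinite square root
of `ρ` with the entries of the intrinsic purification, transposed. -/
lemma exists_posSemidef_sqrt_of_diagonalization {ι : Type*} [Fintype ι] [DecidableEq ι]
    {ρ U : Matrix ι ι ℂ} (hU : U ∈ Matrix.unitaryGroup ι ℂ) {p : ι → ℝ} (hp : ∀ i, 0 ≤ p i)
    (hd : Uᴴ * ρ * U = Matrix.diagonal fun i => (p i : ℂ)) {ψ : ι → ι → ℂ}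
    (hψ : ∀ i j, ψ i j = ∑ k, (Real.sqrt (p k) : ℂ) * star (U i k) * U j k) :
    ∃ A : Matrix ι ι ℂ, A.PosSemidef ∧ A * A = ρ ∧ ∀ i j, ψ i j = A j i := by
  have hUU : U * Uᴴ = 1 := Matrix.mem_unitaryGroup_iff.1 hU
  have hUU' : Uᴴ * U = 1 := Matrix.mem_unitaryGroup_iff'.1 hU
  set S : Matrix ι ι ℂ := Matrix.diagonal fun i => (Real.sqrt (p i) : ℂ) with hS
  have hSS : S * S = Uᴴ * ρ * U := by
    rw [hd, hS, Matrix.diagonal_mul_diagonal]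
    congr 1
    funext i
    rw [← Complex.ofReal_mul, Real.mul_self_sqrt (hp i)]
  refine ⟨U * S * Uᴴ, ?_, ?_, fun i j => ?_⟩
  · refine Matrix.PosSemidef.mul_mul_conjTranspose_same (Matrix.PosSemidef.diagonal ?_) U
    intro i
    exact Complex.zero_le_real.2 (Real.sqrt_nonneg _)
  · calc U * S * Uᴴ * (U * S * Uᴴ) = U * S * (Uᴴ * U) * S * Uᴴ := by
          simp only [Matrix.mul_assoc]
      _ = U * (S * S) * Uᴴ := by rw [hUU', Matrix.mul_one, Matrix.mul_assoc U]
      _ = (U * Uᴴ) * ρ * (U * Uᴴ) := by rw [hSS]; simp only [Matrix.mul_assoc]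
      _ = ρ := by rw [hUU, Matrix.one_mul, Matrix.mul_one]
  · rw [hψ, Matrix.mul_apply]
    refine Finset.sum_congr rfl fun k _ => ?_
    rw [hS, Matrix.mul_diagonal, Matrix.conjTranspose_apply]
    ring

/-- The overlap of the intrinsic purifications is at least
`1 − D(ρ₀,ρ₁)`. -/
theorem intrinsic_purification_overlap_ge
    {n : ℕ} (ρ₀ ρ₁ : Matrix (Fin n) (Fin n) ℂ)
    (hρ₀ : ρ₀.PosSemidef) (hρ₁ : ρ₁.PosSemidef)
    (hτ₀ : ρ₀.trace = 1) (hτ₁ : ρ₁.trace = 1)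
    (U₀ U₁ : Matrix (Fin n) (Fin n) ℂ)
    (hU₀ : U₀ ∈ Matrix.unitaryGroup (Fin n) ℂ)
    (hU₁ : U₁ ∈ Matrix.unitaryGroup (Fin n) ℂ)
    (p₀ p₁ : Fin n → ℝ) (hp₀ : ∀ i, 0 ≤ p₀ i) (hp₁ : ∀ i, 0 ≤ p₁ i)
    (hd₀ : U₀ᴴ * ρ₀ * U₀ = Matrix.diagonal fun i => (p₀ i : ℂ))
    (hd₁ : U₁ᴴ * ρ₁ * U₁ = Matrix.diagonal fun i => (p₁ i : ℂ))
    (ψ₀ ψ₁ : Fin n → Fin n → ℂ)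
    (hψ₀ : ∀ i j, ψ₀ i j = ∑ k, (Real.sqrt (p₀ k) : ℂ) * star (U₀ i k) * U₀ j k)
    (hψ₁ : ∀ i j, ψ₁ i j = ∑ k, (Real.sqrt (p₁ k) : ℂ) * star (U₁ i k) * U₁ j k) :
    1 - traceDist ρ₀ ρ₁ ≤ ‖∑ i, ∑ j, star (ψ₀ i j) * ψ₁ i j‖ := by
  obtain ⟨A, hA, hAA, hψA⟩ := exists_posSemidef_sqrt_of_diagonalization hU₀ hp₀ hd₀ hψ₀
  obtain ⟨B, hB, hBB, hψB⟩ := exists_posSemidef_sqrt_of_diagonalization hU₁ hp₁ hd₁ hψ₁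
  have hoverlap : ∑ i, ∑ j, star (ψ₀ i j) * ψ₁ i j = (A * B).trace := by
    simp only [Matrix.trace, Matrix.diag_apply, Matrix.mul_apply, hψA, hψB]
    refine Finset.sum_congr rfl fun i _ => Finset.sum_congr rfl fun j _ => ?_
    rw [hA.isHermitian.apply]
  have hPS := re_trace_sub_mul_sub_le_traceNorm hA hB
  have hexpand : (((A - B) * (A - B)).trace).re = 2 - 2 * ((A * B).trace).re := by
    rw [Matrix.sub_mul, Matrix.mul_sub, Matrix.mul_sub, Matrix.trace_sub, Matrix.trace_sub,
      Matrix.trace_sub, Matrix.trace_mul_comm B A, hAA, hBB, hτ₀, hτ₁]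
    simp only [Complex.sub_re, Complex.one_re]
    ring
  rw [hexpand, hAA, hBB] at hPS
  have hre := Complex.re_le_norm (A * B).trace
  rw [hoverlap, traceDist]
  linarith
end

section
/- (Lemma 1, finite-dimensional form.) For any density matrices ρ₀ and ρ₁ on ℂⁿ, there exist purifications ψ̂₀ of ρ₀ and ψ̂₁ of ρ₁ in ℂⁿ ⊗ ℂⁿ such that the trace distance between the corresponding pure states satisfies D(ψ̂₀ψ̂₀ᴴ, ψ̂₁ψ̂₁ᴴ) ≤ √(2·D(ρ₀,ρ₁) − D(ρ₀,ρ₁)²); in particular D(ψ̂₀ψ̂₀ᴴ, ψ̂₁ψ̂₁ᴴ) ≤ √(2·D(ρ₀,ρ₁)). -/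
open Matrix Complex Finset
open scoped ComplexOrder

/-- The rank-one matrix `ψψᴴ` associated with a vector `ψ ∈ ℂⁿ ⊗ ℂⁿ`. -/
noncomputable def pureState {m n : ℕ} (ψ : Fin m → Fin n → ℂ) :
    Matrix (Fin m × Fin n) (Fin m × Fin n) ℂ :=
  Matrix.of fun ab cd => ψ ab.1 ab.2 * star (ψ cd.1 cd.2)

section TraceNorm

open scoped MatrixOrder

variable {ι : Type*} [Fintype ι] [DecidableEq ι]

theorem traceNorm_eq_re_trace_abs (A : Matrix ι ι ℂ) :
    traceNorm A = (CFC.abs A).trace.re := rfl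

theorem re_trace_mul_nonneg {A B : Matrix ι ι ℂ} (hA : 0 ≤ A) (hB : 0 ≤ B) :
    0 ≤ (A * B).trace.re := by
  have hsqrt : (CFC.sqrt A)ᴴ = CFC.sqrt A :=
    (nonneg_iff_posSemidef.mp (CFC.sqrt_nonneg A)).1
  have hpos := (nonneg_iff_posSemidef.mp hB).conjTranspose_mul_mul_same (CFC.sqrt A)
  have htrace : (A * B).trace = ((CFC.sqrt A)ᴴ * B * CFC.sqrt A).trace := by
    rw [hsqrt, Matrix.trace_mul_cycle, CFC.sqrt_mul_sqrt_self A hA]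
  rw [htrace]
  exact (Complex.le_def.mp hpos.trace_nonneg).1

/-- A contraction realising the polar decomposition of a Hermitian matrix. -/
theorem exists_mul_eq_abs {A : Matrix ι ι ℂ} (hA : IsSelfAdjoint A) :
    ∃ U : Matrix ι ι ℂ, -1 ≤ U ∧ U ≤ 1 ∧ U * A = CFC.abs A ∧ A * U = CFC.abs A := by
  have hcont : ContinuousOn (fun x : ℝ => (SignType.sign x : ℝ)) (spectrum ℝ A) :=
    A.finite_real_spectrum.continuousOn _
  have habs : CFC.abs A = cfc (fun x : ℝ => |x|) A := CFC.abs_eq_cfc_norm A hA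
  refine ⟨cfc (fun x : ℝ => (SignType.sign x : ℝ)) A, ?_, ?_, ?_, ?_⟩
  · have h : (0 : Matrix ι ι ℂ) ≤ cfc (fun x : ℝ => 1 + (SignType.sign x : ℝ)) A :=
      cfc_nonneg fun x _ => by
        rcases lt_trichotomy x 0 with h | h | h <;> simp [h]
    rw [cfc_const_add 1 _ A hcont hA, map_one] at h
    exact neg_le_iff_add_nonneg'.mpr h
  · exact cfc_le_one _ _ fun x _ => by
      rcases lt_trichotomy x 0 with h | h | h <;> simp [h]
  · conv_lhs => enter [2]; rw [← cfc_id' ℝ A hA]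
    rw [← cfc_mul _ _ A hcont, habs]
    simp
  · conv_lhs => enter [1]; rw [← cfc_id' ℝ A hA]
    rw [← cfc_mul _ _ A (by fun_prop) hcont, habs]
    simp

theorem re_trace_mul_le {U P : Matrix ι ι ℂ} (hU : U ≤ 1) (hP : 0 ≤ P) :
    (U * P).trace.re ≤ P.trace.re := by
  have h := re_trace_mul_nonneg (sub_nonneg.mpr hU) hP
  rw [sub_mul, one_mul, Matrix.trace_sub, Complex.sub_re] at h
  linarith

theorem neg_re_trace_le_re_trace_mul {U P : Matrix ι ι ℂ} (hU : -1 ≤ U) (hP : 0 ≤ P) :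
    -P.trace.re ≤ (U * P).trace.re := by
  have h := re_trace_mul_le (neg_le.mp hU) hP
  rw [neg_mul, Matrix.trace_neg, Complex.neg_re] at h
  linarith

theorem re_trace_mul_le_traceNorm {U A : Matrix ι ι ℂ} (hA : IsSelfAdjoint A)
    (hU : -1 ≤ U) (hU' : U ≤ 1) : (U * A).trace.re ≤ traceNorm A := by
  have hpos := re_trace_mul_le hU' (CFC.posPart_nonneg A)
  have hneg := neg_re_trace_le_re_trace_mul hU (CFC.negPart_nonneg A)
  have hsplit : (U * A).trace.re = (U * A⁺).trace.re - (U * A⁻).trace.re := by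
    rw [← Complex.sub_re, ← Matrix.trace_sub, ← mul_sub, CFC.posPart_sub_negPart A hA]
  rw [traceNorm_eq_re_trace_abs, ← CFC.posPart_add_negPart A hA, Matrix.trace_add, Complex.add_re]
  linarith

theorem traceNorm_sub_le {P Q : Matrix ι ι ℂ} (hP : 0 ≤ P) (hQ : 0 ≤ Q) :
    traceNorm (P - Q) ≤ P.trace.re + Q.trace.re := by
  obtain ⟨U, hU, hU', hUA, -⟩ := exists_mul_eq_abs
    ((IsSelfAdjoint.of_nonneg hP).sub (IsSelfAdjoint.of_nonneg hQ))
  rw [traceNorm_eq_re_trace_abs, ← hUA, mul_sub, Matrix.trace_sub, Complex.sub_re]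
  linarith [re_trace_mul_le hU' hP, neg_re_trace_le_re_trace_mul hU hQ]

/-- The **Powers–Størmer inequality** `‖X - Y‖₂² ≤ ‖X² - Y²‖₁`. -/
theorem re_trace_sub_mul_sub_le_traceNorm_s8 {X Y : Matrix ι ι ℂ} (hX : 0 ≤ X) (hY : 0 ≤ Y) :
    ((X - Y) * (X - Y)).trace.re ≤ traceNorm (X * X - Y * Y) := by
  have hXs := IsSelfAdjoint.of_nonneg hX
  have hYs := IsSelfAdjoint.of_nonneg hY
  have hS : IsSelfAdjoint (X - Y) := hXs.sub hYs
  obtain ⟨U, hU, hU', hUS, hSU⟩ := exists_mul_eq_abs hS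
  have hsq : IsSelfAdjoint (X * X - Y * Y) := by
    refine IsSelfAdjoint.sub ?_ ?_ <;> simp [IsSelfAdjoint, hXs.star_eq, hYs.star_eq]
  refine le_trans ?_ (re_trace_mul_le_traceNorm hsq hU hU')
  have hdouble : 2 * (U * (X * X - Y * Y)).trace = 2 * (CFC.abs (X - Y) * (X + Y)).trace := by
    have hcycle : (U * ((X + Y) * (X - Y))).trace = (CFC.abs (X - Y) * (X + Y)).trace := by
      rw [← hSU, ← mul_assoc, Matrix.trace_mul_cycle]
    have hsum : U * ((X - Y) * (X + Y)) + U * ((X + Y) * (X - Y)) =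
        (2 : ℂ) • (U * (X * X - Y * Y)) := by
      rw [two_smul]; noncomm_ring
    calc 2 * (U * (X * X - Y * Y)).trace
        = (U * ((X - Y) * (X + Y)) + U * ((X + Y) * (X - Y))).trace := by
          rw [hsum, Matrix.trace_smul, smul_eq_mul]
      _ = 2 * (CFC.abs (X - Y) * (X + Y)).trace := by
          rw [Matrix.trace_add, hcycle, ← mul_assoc, hUS, two_mul]
  have htrace := mul_left_cancel₀ two_ne_zero hdouble
  have hpos := re_trace_mul_nonneg (CFC.posPart_nonneg (X - Y)) (add_nonneg hY hY)
  have hneg := re_trace_mul_nonneg (CFC.negPart_nonneg (X - Y)) (add_nonneg hX hX)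
  have hdecomp : CFC.abs (X - Y) * (X + Y) =
      (X - Y) * (X - Y) + (X - Y)⁺ * (Y + Y) + (X - Y)⁻ * (X + X) := by
    conv_rhs => enter [1, 1, 1]; rw [← CFC.posPart_sub_negPart (X - Y) hS]
    rw [← CFC.posPart_add_negPart (X - Y) hS]
    noncomm_ring
  rw [htrace, hdecomp, Matrix.trace_add, Matrix.trace_add, Complex.add_re, Complex.add_re]
  linarith

/-- A Hermitian matrix with `A³ = c A` and `Tr A² = 2c` has at most the eigenvalues `±√c`
and `0`, the first two with total multiplicity two when `c ≠ 0`. -/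
theorem traceNorm_of_cube_eq_smul {A : Matrix ι ι ℂ} {c : ℝ} (hA : IsSelfAdjoint A)
    (hcube : A * A * A = (c : ℂ) • A) (htrace : (A * A).trace = 2 * c) :
    traceNorm A = 2 * √c := by
  have hstar : Aᴴ = A := hA
  have hpos : (A * A).PosSemidef := by
    simpa [hstar] using Matrix.posSemidef_conjTranspose_mul_self A
  have hc : 0 ≤ c := by
    have h := (Complex.le_def.mp hpos.trace_nonneg).1
    rw [htrace] at h
    simpa using h
  rcases hc.eq_or_lt with rfl | hc
  · have hzero : A = 0 := by
      rw [← Matrix.trace_conjTranspose_mul_self_eq_zero_iff, hstar, htrace]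
      simp
    simp [hzero, traceNorm_eq_re_trace_abs]
  · have hsqrt : (√c : ℂ) * √c = c := by
      rw [← Complex.ofReal_mul, Real.mul_self_sqrt hc.le]
    have hne : (√c : ℂ) ≠ 0 := by
      simpa using (Real.sqrt_pos.mpr hc).ne'
    have hroot : CFC.sqrt (Aᴴ * A) = ((√c : ℂ)⁻¹) • (A * A) := by
      refine CFC.sqrt_unique ?_ (nonneg_iff_posSemidef.mpr (hpos.smul ?_))
      · rw [smul_mul_smul_comm, ← mul_assoc, hcube, smul_mul_assoc, smul_smul, hstar, ← hsqrt]
        field_simp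
        simp
      · rw [← Complex.ofReal_inv]
        exact_mod_cast inv_nonneg.mpr (Real.sqrt_nonneg c)
    have hval : (CFC.sqrt (Aᴴ * A)).trace = ((2 * √c : ℝ) : ℂ) := by
      rw [hroot, Matrix.trace_smul, htrace, ← hsqrt, smul_eq_mul]
      push_cast
      field_simp
    rw [traceNorm, hval, Complex.ofReal_re]

theorem traceNorm_vecMulVec_sub {v w : ι → ℂ} (hv : star v ⬝ᵥ v = 1) (hw : star w ⬝ᵥ w = 1) :
    traceNorm (vecMulVec v (star v) - vecMulVec w (star w)) =
      2 * √(1 - Complex.normSq (star v ⬝ᵥ w)) := by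
  set P := vecMulVec v (star v) with hP
  set Q := vecMulVec w (star w) with hQ
  set a := star v ⬝ᵥ w with ha
  have hconj : star w ⬝ᵥ v = star a := by
    rw [ha, Matrix.star_dotProduct]
  have hnormSq : a * star a = (Complex.normSq a : ℂ) := Complex.mul_conj a
  have hPP : P * P = P := by
    simp [hP, vecMulVec_mul_vecMulVec, hv]
  have hQQ : Q * Q = Q := by
    simp [hQ, vecMulVec_mul_vecMulVec, hw]
  have hPQ : P * Q = a • vecMulVec v (star w) := by
    simp [hP, hQ, vecMulVec_mul_vecMulVec, ← ha, vecMulVec_smul]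
  have hQP : Q * P = star a • vecMulVec w (star v) := by
    simp [hP, hQ, vecMulVec_mul_vecMulVec, hconj, vecMulVec_smul]
  have hPQP : P * Q * P = (Complex.normSq a : ℂ) • P := by
    rw [hPQ, hP, smul_mul_assoc, vecMulVec_mul_vecMulVec, hconj, vecMulVec_smul, smul_smul,
      hnormSq]
  have hQPQ : Q * P * Q = (Complex.normSq a : ℂ) • Q := by
    rw [hQP, hQ, smul_mul_assoc, vecMulVec_mul_vecMulVec, ← ha, vecMulVec_smul, smul_smul,
      mul_comm, hnormSq]
  have hsq : (P - Q) * (P - Q) = P + Q - P * Q - Q * P := by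
    rw [mul_sub, sub_mul, sub_mul, hPP, hQQ]
    abel
  apply traceNorm_of_cube_eq_smul
  · exact (posSemidef_vecMulVec_self_star v).1.sub (posSemidef_vecMulVec_self_star w).1
  · have hexpand : (P + Q - P * Q - Q * P) * (P - Q) =
        P * P - Q * Q - P * Q * P + Q * P * Q + (P * (Q * Q) - P * Q)
          + (Q * P - Q * (P * P)) := by
      noncomm_ring
    rw [hsq, hexpand, hPQP, hQPQ, hPP, hQQ]
    push_cast
    module
  · rw [hsq, Matrix.trace_sub, Matrix.trace_sub, Matrix.trace_add, hPQ, hQP, hP, hQ,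
      Matrix.trace_smul, Matrix.trace_smul, trace_vecMulVec, trace_vecMulVec, trace_vecMulVec,
      trace_vecMulVec, dotProduct_comm v, dotProduct_comm w, dotProduct_comm v,
      dotProduct_comm w, hv, hw, hconj, ← ha, smul_eq_mul, smul_eq_mul, hnormSq, mul_comm,
      hnormSq]
    push_cast
    ring

end TraceNorm

open scoped MatrixOrder in
theorem one_sub_traceDist_le_re_trace_sqrt_mul_sqrt {ι : Type*} [Fintype ι] [DecidableEq ι]
    {ρ σ : Matrix ι ι ℂ} (hρ : 0 ≤ ρ) (hσ : 0 ≤ σ) (hτρ : ρ.trace = 1) (hτσ : σ.trace = 1) :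
    1 - traceDist ρ σ ≤ (CFC.sqrt ρ * CFC.sqrt σ).trace.re := by
  have h := re_trace_sub_mul_sub_le_traceNorm_s8 (CFC.sqrt_nonneg ρ) (CFC.sqrt_nonneg σ)
  rw [mul_sub, sub_mul, sub_mul, CFC.sqrt_mul_sqrt_self ρ hρ, CFC.sqrt_mul_sqrt_self σ hσ,
    Matrix.trace_sub, Matrix.trace_sub, Matrix.trace_sub, Matrix.trace_mul_comm (CFC.sqrt σ),
    hτρ, hτσ] at h
  simp only [Complex.sub_re, Complex.one_re] at h
  rw [traceDist]
  linarith

/-- Lemma 1, finite-dimensional form. There exist purifications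
`ψ̂₀` of `ρ₀` and `ψ̂₁` of `ρ₁` with
`D(ψ̂₀ψ̂₀ᴴ, ψ̂₁ψ̂₁ᴴ) ≤ √(2 D(ρ₀,ρ₁) − D(ρ₀,ρ₁)²) ≤ √(2 D(ρ₀,ρ₁))`. -/
theorem exists_purifications_traceDist_le
    {n : ℕ} (ρ₀ ρ₁ : Matrix (Fin n) (Fin n) ℂ)
    (hρ₀ : ρ₀.PosSemidef) (hρ₁ : ρ₁.PosSemidef)
    (hτ₀ : ρ₀.trace = 1) (hτ₁ : ρ₁.trace = 1) :
    ∃ ψ₀ ψ₁ : Fin n → Fin n → ℂ,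
      (∑ i, ∑ j, star (ψ₀ i j) * ψ₀ i j) = 1 ∧
      (∑ i, ∑ j, star (ψ₁ i j) * ψ₁ i j) = 1 ∧
      (∀ j j', (∑ i, ψ₀ i j * star (ψ₀ i j')) = ρ₀ j j') ∧
      (∀ j j', (∑ i, ψ₁ i j * star (ψ₁ i j')) = ρ₁ j j') ∧
      traceDist (pureState ψ₀) (pureState ψ₁)
        ≤ Real.sqrt (2 * traceDist ρ₀ ρ₁ - traceDist ρ₀ ρ₁ ^ 2) ∧
      traceDist (pureState ψ₀) (pureState ψ₁)
        ≤ Real.sqrt (2 * traceDist ρ₀ ρ₁) := by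
  open scoped MatrixOrder in
  have key : ∃ X Y : Matrix (Fin n) (Fin n) ℂ, X * Xᴴ = ρ₀ ∧ Y * Yᴴ = ρ₁ ∧
      1 - traceDist ρ₀ ρ₁ ≤ (Xᴴ * Y).trace.re ∧ traceDist ρ₀ ρ₁ ≤ 1 := by
    have h₀ : 0 ≤ ρ₀ := nonneg_iff_posSemidef.mpr hρ₀
    have h₁ : 0 ≤ ρ₁ := nonneg_iff_posSemidef.mpr hρ₁
    have hs (ρ : Matrix (Fin n) (Fin n) ℂ) : (CFC.sqrt ρ)ᴴ = CFC.sqrt ρ :=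
      (nonneg_iff_posSemidef.mp (CFC.sqrt_nonneg ρ)).1
    refine ⟨CFC.sqrt ρ₀, CFC.sqrt ρ₁, ?_, ?_, ?_, ?_⟩
    · rw [hs, CFC.sqrt_mul_sqrt_self ρ₀ h₀]
    · rw [hs, CFC.sqrt_mul_sqrt_self ρ₁ h₁]
    · rw [hs]
      exact one_sub_traceDist_le_re_trace_sqrt_mul_sqrt h₀ h₁ hτ₀ hτ₁
    · have h := traceNorm_sub_le h₀ h₁
      rw [hτ₀, hτ₁, Complex.one_re] at h
      rw [traceDist]
      linarith
  obtain ⟨X, Y, hX, hY, hoverlap, hle⟩ := key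
  have hinner (A B : Matrix (Fin n) (Fin n) ℂ) :
      ∑ i, ∑ j, star (A j i) * B j i = (Aᴴ * B).trace := by
    simp [Matrix.trace, Matrix.mul_apply]
  have hdot (A B : Matrix (Fin n) (Fin n) ℂ) :
      star (fun p : Fin n × Fin n => A p.2 p.1) ⬝ᵥ (fun p => B p.2 p.1) = (Aᴴ * B).trace := by
    rw [← hinner, ← Fintype.sum_prod_type']
    rfl
  have hXX : (Xᴴ * X).trace = 1 := by rw [Matrix.trace_mul_comm, hX, hτ₀]
  have hYY : (Yᴴ * Y).trace = 1 := by rw [Matrix.trace_mul_comm, hY, hτ₁]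
  have hpure : traceDist (pureState fun i j => X j i) (pureState fun i j => Y j i) =
      √(1 - Complex.normSq (Xᴴ * Y).trace) := by
    have h := traceNorm_vecMulVec_sub ((hdot X X).trans hXX) ((hdot Y Y).trans hYY)
    rw [hdot] at h
    have h' : traceDist (pureState fun i j => X j i) (pureState fun i j => Y j i) =
        2 * √(1 - Complex.normSq (Xᴴ * Y).trace) / 2 := congrArg (· / 2) h
    rw [h']
    ring
  have hbound : traceDist (pureState fun i j => X j i) (pureState fun i j => Y j i) ≤
      √(2 * traceDist ρ₀ ρ₁ - traceDist ρ₀ ρ₁ ^ 2) := by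
    rw [hpure]
    apply Real.sqrt_le_sqrt
    rw [Complex.normSq_apply]
    nlinarith [mul_self_le_mul_self (sub_nonneg.mpr hle) hoverlap,
      mul_self_nonneg (Xᴴ * Y).trace.im]
  refine ⟨fun i j => X j i, fun i j => Y j i, (hinner X X).trans hXX, (hinner Y Y).trans hYY,
    fun j j' => ?_, fun j j' => ?_, hbound, hbound.trans (Real.sqrt_le_sqrt ?_)⟩
  · rw [← hX, Matrix.mul_apply]
    rfl
  · rw [← hY, Matrix.mul_apply]
    rfl
  · linarith [sq_nonneg (traceDist ρ₀ ρ₁)]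
end
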